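/- Let R be a Noetherian commutative ring, N a finitely generated R-module, and I an ideal of R. Let S = R ∖ ∪{ p : p ∈ mAss_R N/IN } and write (I^n)^{⟨N⟩}_a = S((I^n)^{(N)}_a). Then Q̄*(I, N) = mAss_R N/IN if and only if the topologies defined by {(I^n)^{(N)}_a}_{n≥1} and {(I^n)^{⟨N⟩}_a}_{n≥1} are equivalent, i.e. if and only if for every n ≥ 1 there exists k ≥ 1 with (I^k)^{⟨N⟩}_a ⊆ (I^n)^{(N)}_a. -/

import Mathlib

open Pointwise

section Defs

variable {R : Type} [CommRing R]

/-- `x` is integrally dependent on the ideal `I` relative to the module `N`: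
`x ^ n • N ⊆ ∑_{i=1}^n x^(n-i) • (I^i • N)` for some `n ≥ 1`. -/
def Ideal.RelIntDep (I : Ideal R) (N : Type) [AddCommGroup N] [Module R N] (x : R) : Prop :=
  ∃ n : ℕ, 0 < n ∧ ∀ m : N, x ^ n • m ∈
    ⨆ i ∈ Finset.Icc 1 n, x ^ (n - i) • (I ^ i • (⊤ : Submodule R N))

/-- The integral closure `I^{(N)}_a` of `I` relative to `N`, as a subset of `R`. -/
def Ideal.relIntClosure (I : Ideal R) (N : Type) [AddCommGroup N] [Module R N] : Set R :=
  {x | I.RelIntDep N x}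

/-- The classical integral closure `I_a` of an ideal, as a subset of `R`. -/
def Ideal.intClosure (I : Ideal R) : Set R :=
  {x | ∃ n : ℕ, 0 < n ∧ ∃ r : ℕ → R, (∀ i ∈ Finset.Icc 1 n, r i ∈ I ^ i) ∧
    x ^ n + ∑ i ∈ Finset.Icc 1 n, r i * x ^ (n - i) = 0}

/-- `mAss_R N`: the set of minimal members of `Ass_R N`. -/
def mAss (R : Type) [CommRing R] (N : Type) [AddCommGroup N] [Module R N] : Set (Ideal R) :=
  {p | Minimal (· ∈ associatedPrimes R N) p}

/-- `Ass_R (R/J)` for a subset `J ⊆ R`: primes of the form `(J :_R x)`. -/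
def assQuot (J : Set R) : Set (Ideal R) :=
  {p | p.IsPrime ∧ ∃ x : R, (p : Set R) = {r : R | r * x ∈ J}}

/-- `Ass_R (J/K)` for subsets `K ⊆ J` of `R`: primes of the form `(K :_R x)` with `x ∈ J`. -/
def assQuot₂ (J K : Set R) : Set (Ideal R) :=
  {p | p.IsPrime ∧ ∃ x ∈ J, (p : Set R) = {r : R | r * x ∈ K}}

/-- `S(J) = ∪_{s ∈ S} (J :_R s)`. -/
def sat (S : Set R) (J : Set R) : Set R := {x | ∃ s ∈ S, s * x ∈ J}

/-- `(J :_R K)` for subsets of `R`. -/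
def setColon (J K : Set R) : Set R := {x | ∀ y ∈ K, x * y ∈ J}

/-- `(J :_R ⟨K⟩) = ∪_{n ≥ 1} (J :_R K^n)`. -/
def colonPow (J : Set R) (K : Ideal R) : Set R :=
  {x | ∃ n : ℕ, 0 < n ∧ ∀ y ∈ K ^ n, x * y ∈ J}

end Defs
section Quint

variable {R : Type} [CommRing R]

/-- Auxiliary: the quintasymptotic condition at a prime `p`: there is a minimal associated
prime `q` of the completion `N̂ₚ` of `Nₚ` over the completion `R̂ₚ` of `Rₚ` with
`Rad(I·R̂ₚ + q) = p·R̂ₚ`. -/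
def Ideal.quintAux (I p : Ideal R) (N : Type) [AddCommGroup N] [Module R N] [p.IsPrime] : Prop :=
  ∃ q : Ideal (AdicCompletion (IsLocalRing.maximalIdeal (Localization.AtPrime p))
      (Localization.AtPrime p)),
    q ∈ mAss (AdicCompletion (IsLocalRing.maximalIdeal (Localization.AtPrime p))
        (Localization.AtPrime p))
      (AdicCompletion (IsLocalRing.maximalIdeal (Localization.AtPrime p))
        (LocalizedModule p.primeCompl N)) ∧
    (I.map ((algebraMap (Localization.AtPrime p)
        (AdicCompletion (IsLocalRing.maximalIdeal (Localization.AtPrime p))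
          (Localization.AtPrime p))).comp (algebraMap R (Localization.AtPrime p))) ⊔ q).radical =
      p.map ((algebraMap (Localization.AtPrime p)
        (AdicCompletion (IsLocalRing.maximalIdeal (Localization.AtPrime p))
          (Localization.AtPrime p))).comp (algebraMap R (Localization.AtPrime p)))

/-- `p ∈ Q̄*(I, N)`: `p` is a quintasymptotic prime of `I` with respect to `N`. -/
def Ideal.IsQuintasymptotic (I p : Ideal R) (N : Type) [AddCommGroup N] [Module R N] : Prop :=
  ∃ hp : p.IsPrime, @Ideal.quintAux R _ I p N _ _ hp

end Quint

section IntegralClosureModulo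

open Polynomial

variable {A B : Type*} [CommRing A] [CommRing B]

/-- `x` satisfies, modulo the ideal `a`, an equation of integral dependence on `I`. -/
def Ideal.IntDepMod (I a : Ideal A) (x : A) : Prop :=
  ∃ d : ℕ, ∃ e : ℕ → A, (∀ k < d, e k ∈ I ^ (d - k)) ∧
    x ^ d + ∑ k ∈ Finset.range d, e k * x ^ k ∈ a

namespace Ideal.IntDepMod

variable {I J a b : Ideal A} {x : A}

lemma exists_pos (h : I.IntDepMod a x) :
    ∃ d : ℕ, 0 < d ∧ ∃ e : ℕ → A, (∀ k < d, e k ∈ I ^ (d - k)) ∧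
      x ^ d + ∑ k ∈ Finset.range d, e k * x ^ k ∈ a := by
  obtain ⟨d, e, he, hx⟩ := h
  refine ⟨d + 1, d.succ_pos, fun k ↦ if k = 0 then 0 else e (k - 1), ?_, ?_⟩
  · rintro (_ | k) hk
    · simp
    · simpa using he k (by omega)
  · rw [Finset.sum_range_succ']
    have := a.mul_mem_left x hx
    convert this using 1
    simp only [Nat.add_eq_zero_iff, one_ne_zero, and_false, ↓reduceIte, Nat.add_sub_cancel,
      zero_mul, add_zero, mul_add, Finset.mul_sum]
    congr 1
    · ring
    · exact Finset.sum_congr rfl fun k _ ↦ by ring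

lemma map (h : I.IntDepMod a x) (f : A →+* B) {I' a' : Ideal B} (hI : I.map f ≤ I')
    (ha : a.map f ≤ a') : I'.IntDepMod a' (f x) := by
  obtain ⟨d, e, he, hx⟩ := h
  refine ⟨d, fun k ↦ f (e k), fun k hk ↦ ?_, ?_⟩
  · apply Ideal.pow_right_mono hI
    rw [← Ideal.map_pow]
    exact Ideal.mem_map_of_mem f (he k hk)
  · simpa using ha (Ideal.mem_map_of_mem f hx)

lemma of_pow_mem {d : ℕ} (h : x ^ d ∈ a) : I.IntDepMod a x :=
  ⟨d, 0, by simp, by simpa using h⟩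

lemma of_mem (h : x ∈ I) : I.IntDepMod a x :=
  ⟨1, fun _ ↦ -x, by simpa using h, by simp⟩

lemma of_monic {p : A[X]} (hp : p.Monic) (hc : ∀ k, p.coeff k ∈ I ^ (p.natDegree - k))
    (hx : p.eval x ∈ a) : I.IntDepMod a x := by
  refine ⟨p.natDegree, p.coeff, fun k _ ↦ hc k, ?_⟩
  rw [eval_eq_sum_range, Finset.sum_range_succ, hp.coeff_natDegree, one_mul, add_comm] at hx
  exact hx

end Ideal.IntDepMod

lemma Ideal.isIntegral_monomial_iff {I : Ideal A} {x : A} :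
    IsIntegral (reesAlgebra I) (monomial 1 x : A[X]) ↔ I.IntDepMod ⊥ x := by
  constructor
  · rintro ⟨p, hp, hx⟩
    rw [eval₂_eq_sum_range, Finset.sum_range_succ, hp.coeff_natDegree] at hx
    refine ⟨p.natDegree, fun k ↦ (p.coeff k : A[X]).coeff (p.natDegree - k),
      fun k _ ↦ (p.coeff k).2 _, ?_⟩
    have := congrArg (fun q : A[X] ↦ q.coeff p.natDegree) hx
    simp only [map_one, one_mul, monomial_pow, coeff_add, finsetSum_coeff, coeff_zero] at this
    rw [Ideal.mem_bot, ← this, add_comm]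
    congr 1
    · refine Finset.sum_congr rfl fun k hk ↦ ?_
      have hk := Finset.mem_range.mp hk
      have h2 : p.natDegree = p.natDegree - k + k := by omega
      conv_rhs => rw [h2, coeff_mul_monomial]
      rfl
    · simp
  · rintro ⟨d, e, he, hx⟩
    let q : (reesAlgebra I)[X] := ∑ k : Fin d,
      C ⟨monomial (d - k) (e k), reesAlgebra.monomial_mem.mpr (he k k.2)⟩ * X ^ (k : ℕ)
    refine ⟨X ^ d + q, monic_X_pow_add (degree_sum_fin_lt _), ?_⟩
    have h1 (k : Fin d) : (monomial (d - k) (e k) : A[X]) * (monomial 1 x) ^ (k : ℕ) =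
        monomial d (e k * x ^ (k : ℕ)) := by
      rw [monomial_pow, monomial_mul_monomial]
      congr 2
      have := k.2; omega
    simp only [q, eval₂_add, eval₂_X_pow, eval₂_finsetSum, eval₂_mul, eval₂_C]
    have h2 (k : Fin d) : algebraMap (reesAlgebra I) A[X]
        ⟨monomial (d - k) (e k), reesAlgebra.monomial_mem.mpr (he k k.2)⟩ =
          monomial (d - k) (e k) := rfl
    simp only [h2, h1]
    rw [monomial_pow, one_mul, ← map_sum, ← map_add,
      Fin.sum_univ_eq_sum_range (fun k ↦ e k * x ^ k), (Ideal.mem_bot).mp hx, map_zero]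

/-- The integral closure of an ideal `I` modulo an ideal `a`: the preimage of the integral
closure of the image of `I` in `A ⧸ a`. -/
def Ideal.integralClosureMod (I a : Ideal A) : Ideal A :=
  Ideal.comap (Ideal.Quotient.mk a)
    { carrier := {y | IsIntegral (reesAlgebra (I.map (Ideal.Quotient.mk a)))
        (monomial 1 y : (A ⧸ a)[X])}
      add_mem' := fun {y z} hy hz ↦ by
        simpa only [Set.mem_ofPred_eq, map_add] using IsIntegral.add hy hz
      zero_mem' := by simpa using isIntegral_zero
      smul_mem' := fun c y hy ↦ by
        have h : (monomial 1 (c • y) : (A ⧸ a)[X]) = C c * monomial 1 y := by simp [C_mul_monomial]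
        rw [Set.mem_ofPred_eq, h]
        exact (isIntegral_algebraMap (R := reesAlgebra (I.map (Ideal.Quotient.mk a)))
          (x := algebraMap (A ⧸ a) _ c)).mul hy }

lemma Ideal.mem_integralClosureMod {I a : Ideal A} {x : A} :
    x ∈ I.integralClosureMod a ↔ I.IntDepMod a x := by
  change IsIntegral (reesAlgebra (I.map (Ideal.Quotient.mk a)))
    (monomial 1 (Ideal.Quotient.mk a x) : (A ⧸ a)[X]) ↔ _
  rw [Ideal.isIntegral_monomial_iff]
  refine ⟨?_, fun h ↦ h.map _ le_rfl (Ideal.map_quotient_self a).le⟩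
  rintro ⟨d, e, he, hx⟩
  have h (k : ℕ) : ∃ c : A, k < d → c ∈ I ^ (d - k) ∧ Ideal.Quotient.mk a c = e k := by
    by_cases hk : k < d
    · have := he k hk
      rw [← Ideal.map_pow,
        Ideal.mem_map_iff_of_surjective _ Ideal.Quotient.mk_surjective] at this
      obtain ⟨c, hc⟩ := this
      exact ⟨c, fun _ ↦ hc⟩
    · exact ⟨0, fun h ↦ absurd h hk⟩
  choose c hc using h
  refine ⟨d, c, fun k hk ↦ (hc k hk).1, ?_⟩
  rw [← Ideal.Quotient.eq_zero_iff_mem, ← (Ideal.mem_bot).mp hx]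
  simp only [map_add, map_pow, map_sum, map_mul]
  congr 1
  exact Finset.sum_congr rfl fun k hk ↦ by rw [(hc k (Finset.mem_range.mp hk)).2]

lemma Ideal.map_integralClosureMod_le {I a : Ideal A} (f : A →+* B) {I' a' : Ideal B}
    (hI : I.map f ≤ I') (ha : a.map f ≤ a') :
    (I.integralClosureMod a).map f ≤ I'.integralClosureMod a' :=
  Ideal.map_le_iff_le_comap.mpr fun _ hx ↦
    Ideal.mem_integralClosureMod.mpr ((Ideal.mem_integralClosureMod.mp hx).map f hI ha)

lemma Ideal.integralClosureMod_mono {I J : Ideal A} (a : Ideal A) (h : I ≤ J) :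
    I.integralClosureMod a ≤ J.integralClosureMod a := by
  simpa using Ideal.map_integralClosureMod_le (RingHom.id A) (a' := a)
    (by simpa using h) (by simp)

lemma Ideal.sup_le_integralClosureMod (I a : Ideal A) : I ⊔ a ≤ I.integralClosureMod a :=
  sup_le (fun _ hx ↦ Ideal.mem_integralClosureMod.mpr (.of_mem hx))
    fun x hx ↦ Ideal.mem_integralClosureMod.mpr (.of_pow_mem (d := 1) (by simpa using hx))

/-- Integral dependence descends along a ring homomorphism for which extended ideals contract
to their saturation at `p`. -/
lemma Ideal.IntDepMod.exists_mul_of_map {f : A →+* B} {p : Ideal A} [p.IsPrime]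
    (hf : ∀ (b : Ideal A) (r : A), f r ∈ b.map f → ∃ u ∉ p, u * r ∈ b) {I a : Ideal A} {x : A}
    (h : (I.map f).IntDepMod (a.map f) (f x)) : ∃ u ∉ p, I.IntDepMod a (u * x) := by
  obtain ⟨d, hd, e, he, hx⟩ := h.exists_pos
  have key : f (x ^ d) ∈ ((⨆ k : Fin d, Ideal.span {x ^ (k : ℕ)} * I ^ (d - k)) ⊔ a).map f := by
    rw [Ideal.map_sup, Ideal.map_iSup]
    have : f (x ^ d) = - ∑ k ∈ Finset.range d, e k * f x ^ k +
        (f x ^ d + ∑ k ∈ Finset.range d, e k * f x ^ k) := by simp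
    rw [this]
    refine Submodule.add_mem_sup (neg_mem ?_) hx
    rw [← Fin.sum_univ_eq_sum_range (fun k ↦ e k * f x ^ k)]
    refine Submodule.sum_mem _ fun k _ ↦ Submodule.mem_iSup_of_mem k ?_
    rw [Ideal.map_mul, Ideal.map_pow, Ideal.map_span, Set.image_singleton, mul_comm (e k), map_pow]
    exact Ideal.mul_mem_mul (Ideal.mem_span_singleton_self _) (he k k.2)
  obtain ⟨u, hu, hux⟩ := hf _ _ key
  refine ⟨u, hu, ?_⟩
  obtain ⟨y, hy, z, hz, hyz⟩ := Submodule.mem_sup.mp hux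
  obtain ⟨g, hg, hgy⟩ := (Submodule.mem_iSup_iff_exists_finsupp _ _).mp hy
  have hg' (k : Fin d) : ∃ c ∈ I ^ (d - (k : ℕ)), x ^ (k : ℕ) * c = g k :=
    Ideal.mem_span_singleton_mul.mp (hg k)
  choose c hc hcg using hg'
  have hy' : y = ∑ k : Fin d, x ^ (k : ℕ) * c k := by
    rw [← hgy, Finsupp.sum_fintype _ _ (by simp)]
    simp [hcg]
  refine ⟨d, fun k ↦ if hk : k < d then - (u ^ (d - 1 - k) * c ⟨k, hk⟩) else 0, fun k hk ↦ ?_, ?_⟩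
  · simp only [hk, dite_true]
    exact neg_mem (Ideal.mul_mem_left _ _ (hc ⟨k, hk⟩))
  · rw [← Fin.sum_univ_eq_sum_range (fun k ↦ (if hk : k < d then _ else _) * (u * x) ^ k)]
    have h1 : ∑ k : Fin d, (if hk : (k : ℕ) < d then - (u ^ (d - 1 - k) * c ⟨k, hk⟩) else 0) *
        (u * x) ^ (k : ℕ) = - (u ^ (d - 1) * y) := by
      rw [hy', Finset.mul_sum, ← Finset.sum_neg_distrib]
      refine Finset.sum_congr rfl fun k _ ↦ ?_
      have hk : u ^ (d - 1) = u ^ (d - 1 - k) * u ^ (k : ℕ) := by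
        rw [← pow_add]; congr 1; have := k.2; omega
      simp only [k.2, dite_true, hk]
      ring
    have h2 : (u * x) ^ d = u ^ (d - 1) * (u * x ^ d) := by
      have : u ^ d = u ^ (d - 1) * u := by rw [← pow_succ]; congr 1; omega
      rw [mul_pow, this]; ring
    rw [h1, h2, ← hyz, mul_add, add_comm, neg_add_cancel_left]
    exact a.mul_mem_left _ hz

end IntegralClosureModulo

section RelativeToModule

open Polynomial

variable {R : Type} [CommRing R] {N : Type} [AddCommGroup N] [Module R N]

lemma Ideal.RelIntDep.intDepMod [IsNoetherian R N] {I : Ideal R} {x : R}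
    (h : I.RelIntDep N x) : I.IntDepMod (Module.annihilator R N) x := by
  obtain ⟨n, hn, hx⟩ := h
  let M : Submodule R N :=
    ⨆ i ∈ Finset.range n, x ^ (n - 1 - i) • (I ^ i • (⊤ : Submodule R N))
  have le_M (j : ℕ) (hj : j < n) : x ^ (n - 1 - j) • (I ^ j • (⊤ : Submodule R N)) ≤ M :=
    le_iSup₂_of_le j (Finset.mem_range.mpr hj) le_rfl
  have key (j : ℕ) (hj : j < n) :
      x ^ (n - 1 - j) • (I ^ (j + 1) • (⊤ : Submodule R N)) ≤ I • M := by
    rw [pow_succ', mul_smul]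
    have : x ^ (n - 1 - j) • (I • (I ^ j • (⊤ : Submodule R N))) =
        I • (x ^ (n - 1 - j) • (I ^ j • (⊤ : Submodule R N))) :=
      Submodule.map_smul'' _ _ _
    rw [this]
    exact Submodule.smul_mono le_rfl (le_M j hj)
  have hxM : x • M ≤ I • M := by
    rintro _ ⟨y, hy, rfl⟩
    suffices M ≤ (I • M).comap (LinearMap.lsmul R N x) from this hy
    refine iSup₂_le fun i hi ↦ ?_
    have hi := Finset.mem_range.mp hi
    rintro _ ⟨z, hz, rfl⟩
    change x • x ^ (n - 1 - i) • z ∈ I • M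
    rw [← mul_smul, ← pow_succ']
    rcases i with _ | i
    · rw [show n - 1 - 0 + 1 = n by omega]
      have hle : (⨆ i ∈ Finset.Icc 1 n, x ^ (n - i) • (I ^ i • (⊤ : Submodule R N))) ≤ I • M := by
        refine iSup₂_le fun i hi ↦ ?_
        obtain ⟨h1, h2⟩ := Finset.mem_Icc.mp hi
        have := key (i - 1) (by omega)
        rwa [show n - 1 - (i - 1) = n - i by omega, show i - 1 + 1 = i by omega] at this
      exact hle (hx z)
    · rw [show n - 1 - (i + 1) + 1 = n - 1 - i by omega]
      exact key i (by omega) (Submodule.smul_mem_pointwise_smul _ _ _ hz)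
  obtain ⟨p, hp, -, hc, hpx⟩ :=
    LinearMap.exists_monic_and_natDegree_eq_and_coeff_mem_pow_and_aeval_eq_zero R
      (algebraMap R (Module.End R M) x) I (by
        rintro _ ⟨y, rfl⟩
        rw [Submodule.mem_smul_top_iff]
        exact hxM (Submodule.smul_mem_pointwise_smul _ _ _ y.2))
  rw [aeval_algebraMap_apply] at hpx
  rcases subsingleton_or_nontrivial R with _ | _
  · exact .of_pow_mem (d := 0) (by simp [Subsingleton.elim (1 : R) 0])
  refine Ideal.IntDepMod.of_monic (p := X ^ (n - 1) * p) ((monic_X_pow _).mul hp) (fun k ↦ ?_) ?_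
  · rw [coeff_X_pow_mul', (monic_X_pow _).natDegree_mul hp, natDegree_X_pow]
    split_ifs with hk
    · rw [show n - 1 + p.natDegree - k = p.natDegree - (k - (n - 1)) by omega]
      exact hc _
    · exact zero_mem _
  · rw [Module.mem_annihilator]
    intro m
    have hm : x ^ (n - 1) • m ∈ M :=
      le_M 0 hn (Submodule.smul_mem_pointwise_smul _ _ _ (by simp))
    have := congrArg (fun f : Module.End R M ↦ ((f ⟨_, hm⟩ : M) : N)) hpx
    simp only [coe_aeval_eq_eval] at this
    change eval x p • x ^ (n - 1) • m = 0 at this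
    rw [eval_mul, eval_pow, eval_X, mul_comm, mul_smul, this]

lemma Ideal.IntDepMod.relIntDep {I : Ideal R} {x : R}
    (h : I.IntDepMod (Module.annihilator R N) x) : I.RelIntDep N x := by
  obtain ⟨d, hd, e, he, hx⟩ := h.exists_pos
  refine ⟨d, hd, fun m ↦ ?_⟩
  have hm := Module.mem_annihilator.mp hx m
  rw [add_smul, add_eq_zero_iff_eq_neg, Finset.sum_smul] at hm
  rw [hm]
  refine neg_mem (Submodule.sum_mem _ fun k hk ↦ ?_)
  have hk := Finset.mem_range.mp hk
  refine Submodule.mem_iSup_of_mem (d - k) (Submodule.mem_iSup_of_mem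
    (Finset.mem_Icc.mpr ⟨by omega, by omega⟩) ?_)
  rw [mul_comm, mul_smul, show d - (d - k) = k by omega]
  exact Submodule.smul_mem_pointwise_smul _ _ _ (Submodule.smul_mem_smul (he k hk) trivial)

lemma Ideal.relIntClosure_eq_integralClosureMod [IsNoetherian R N] (I : Ideal R) :
    I.relIntClosure N = I.integralClosureMod (Module.annihilator R N) := by
  ext x
  rw [SetLike.mem_coe, Ideal.mem_integralClosureMod]
  exact ⟨Ideal.RelIntDep.intDepMod, Ideal.IntDepMod.relIntDep⟩

end RelativeToModule

section Vanishing

lemma Ideal.exists_mul_pow_mem_of_mem_minimalPrimes {A : Type*} [CommRing A] {I p : Ideal A}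
    (hp : p ∈ I.minimalPrimes) {x : A} (hx : x ∈ p) : ∃ y ∉ p, ∃ n : ℕ, y * x ^ n ∈ I := by
  have := hp.isPrime
  have h := IsLocalization.AtPrime.radical_map_of_mem_minimalPrimes
    (Localization.AtPrime p) p I hp
  have hx' : algebraMap A (Localization.AtPrime p) x ∈
      (I.map (algebraMap A (Localization.AtPrime p))).radical := by
    rw [h]
    exact Ideal.mem_map_of_mem _ hx
  obtain ⟨n, hn⟩ := hx'
  rw [← map_pow, IsLocalization.algebraMap_mem_map_algebraMap_iff p.primeCompl] at hn
  obtain ⟨y, hy, h⟩ := hn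
  exact ⟨y, hy, n, h⟩

lemma Ideal.exists_mul_pow_eq_of_mem_minimalPrimes {A : Type*} [CommRing A] [IsDomain A]
    [IsNoetherianRing A] {u c : A} {Q : Ideal A} (hQ : Q ∈ (Ideal.span {u}).minimalPrimes)
    (hc : c ≠ 0) : ∃ s ∉ Q, ∃ (t : ℕ) (d : A), s * u ^ t = c * d := by
  have := hQ.isPrime
  by_cases hcQ : c ∈ Q
  · have h1 := Ideal.height_le_one_of_isPrincipal_of_mem_minimalPrimes _ Q hQ
    have h2 := Ideal.one_le_height_span_singleton_of_mem_nonZeroDivisors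
      (mem_nonZeroDivisors_of_ne_zero hc)
    have hmin : Q ∈ (Ideal.span {c}).minimalPrimes :=
      Ideal.mem_minimalPrimes_of_height_le ((Ideal.span_singleton_le_iff_mem _).2 hcQ)
        (h1.trans h2)
    obtain ⟨s, hs, t, h⟩ := Ideal.exists_mul_pow_mem_of_mem_minimalPrimes hmin
      (hQ.1.2 (Ideal.mem_span_singleton_self u))
    obtain ⟨d, hd⟩ := Ideal.mem_span_singleton.1 h
    exact ⟨s, hs, t, d, hd⟩
  · exact ⟨c, hcQ, 0, 1, by simp⟩

lemma Ideal.eq_zero_of_forall_mem_integralClosureMod_span_pow {A : Type*} [CommRing A] [IsDomain A]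
    [IsNoetherianRing A] {u c : A} (hu0 : u ≠ 0) (hu : ¬ IsUnit u)
    (hc : ∀ n, 1 ≤ n → c ∈ (Ideal.span {u} ^ n).integralClosureMod ⊥) : c = 0 := by
  by_contra hc0
  obtain ⟨⟨Q, hQ⟩⟩ := Ideal.nonempty_minimalPrimes
    (mt Ideal.span_singleton_eq_top.1 hu : Ideal.span {u} ≠ ⊤)
  have := hQ.isPrime
  obtain ⟨s, hs, t, d, hd⟩ := Ideal.exists_mul_pow_eq_of_mem_minimalPrimes hQ hc0
  obtain ⟨r, e, he, hx⟩ := Ideal.mem_integralClosureMod.1 (hc (t + 1) (by omega))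
  have hf : ∀ k, ∃ f, k < r → e k = f * u ^ ((t + 1) * (r - k)) := by
    intro k
    by_cases hk : k < r
    · have := he k hk
      rw [← pow_mul, Ideal.span_singleton_pow] at this
      obtain ⟨f, hf⟩ := Ideal.mem_span_singleton.1 this
      exact ⟨f, fun _ ↦ by rw [hf, mul_comm]⟩
    · exact ⟨0, fun h ↦ (hk h).elim⟩
  choose f hf using hf
  have key : u ^ (t * r) * (s ^ r + u * ∑ k ∈ Finset.range r,
      f k * d ^ (r - k) * s ^ k * u ^ (r - k - 1)) = 0 := by
    rw [Ideal.mem_bot] at hx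
    have h0 : d ^ r * (c ^ r + ∑ k ∈ Finset.range r, e k * c ^ k) = 0 := by rw [hx, mul_zero]
    rw [← h0, mul_add, mul_add, ← mul_pow, mul_comm d c, ← hd, Finset.mul_sum, Finset.mul_sum,
      Finset.mul_sum]
    congr 1
    · rw [mul_pow, ← pow_mul]; ring
    · refine Finset.sum_congr rfl fun k hk ↦ ?_
      have hk := Finset.mem_range.1 hk
      obtain ⟨j, rfl⟩ := Nat.exists_eq_add_of_lt hk
      rw [hf k hk, show k + j + 1 - k = j + 1 by omega, Nat.add_sub_cancel]
      have : d ^ (k + j + 1) * (f k * u ^ ((t + 1) * (j + 1)) * c ^ k) =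
          f k * u ^ ((t + 1) * (j + 1)) * d ^ (j + 1) * (c * d) ^ k := by ring
      rw [this, ← hd]
      ring
  rw [mul_eq_zero, or_iff_right (pow_ne_zero _ hu0), add_eq_zero_iff_eq_neg] at key
  refine hs (this.mem_of_pow_mem r ?_)
  rw [key]
  exact Q.neg_mem (Q.mul_mem_right _ (hQ.1.2 (Ideal.mem_span_singleton_self u)))

open LaurentPolynomial in
/-- The extended Rees algebra of the ideal generated by `g`. -/
noncomputable def Ideal.extendedRees {B : Type*} [CommRing B] (g : Set B) : Subalgebra B B[T;T⁻¹] :=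
  Algebra.adjoin B ({T (-1)} ∪ (fun a ↦ C a * T 1) '' g)

open LaurentPolynomial in
lemma Ideal.coeff_mem_of_mem_extendedRees {B : Type*} [CommRing B] {g : Set B} {f : B[T;T⁻¹]}
    (hf : f ∈ Ideal.extendedRees g) (n : ℤ) : f.coeff n ∈ Ideal.span g ^ n.toNat := by
  induction hf using Algebra.adjoin_induction generalizing n with
  | mem x hx =>
    rcases hx with rfl | ⟨a, ha, rfl⟩
    · rw [LaurentPolynomial.T_apply]
      split_ifs with h
      · subst h; simp
      · exact zero_mem _
    · dsimp only
      rw [← single_eq_C_mul_T, AddMonoidAlgebra.coeff_single, Finsupp.single_apply]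
      split_ifs with h
      · subst h; simpa using Ideal.subset_span ha
      · exact zero_mem _
  | algebraMap r =>
    rw [LaurentPolynomial.algebraMap_apply, LaurentPolynomial.C_apply]
    split_ifs with h
    · subst h; simp
    · exact zero_mem _
  | add x y _ _ hx hy => exact add_mem (hx n) (hy n)
  | mul x y _ _ hx hy =>
    rw [AddMonoidAlgebra.coeff_mul]
    refine Submodule.sum_mem _ fun i _ ↦ Submodule.sum_mem _ fun j _ ↦ ?_
    dsimp only
    split_ifs with h
    · refine Ideal.pow_le_pow_right (show n.toNat ≤ i.toNat + j.toNat by omega) ?_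
      rw [pow_add]
      exact Ideal.mul_mem_mul (hx i) (hy j)
    · exact zero_mem _

open LaurentPolynomial in
lemma Ideal.eq_zero_of_forall_mem_integralClosureMod_pow {B : Type*} [CommRing B] [IsDomain B]
    [IsNoetherianRing B] {J : Ideal B} (hJ : J ≠ ⊤) {c : B}
    (hc : ∀ n, 1 ≤ n → c ∈ (J ^ n).integralClosureMod ⊥) : c = 0 := by
  obtain ⟨g, rfl⟩ := (isNoetherianRing_iff_ideal_fg B).1 inferInstance J
  let E := Ideal.extendedRees (g : Set B)
  have hT : T (-1) ∈ E := Algebra.subset_adjoin (.inl rfl)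
  have hg : ∀ a ∈ g, C a * T 1 ∈ E := fun a ha ↦ Algebra.subset_adjoin (.inr ⟨a, ha, rfl⟩)
  have : IsNoetherianRing E := by
    refine isNoetherianRing_of_fg (Subalgebra.fg_def.2 ⟨_, ?_, rfl⟩)
    exact (Set.finite_singleton _).union (g.finite_toSet.image _)
  let u : E := ⟨T (-1), hT⟩
  have hu0 : u ≠ 0 := by
    intro h
    have h1 := congrArg (· * (T 1 : B[T;T⁻¹])) (congrArg Subtype.val h)
    simp only [u, ZeroMemClass.coe_zero, zero_mul, ← T_add] at h1
    simp at h1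
  have hu : ¬ IsUnit u := by
    intro h
    obtain ⟨v, hv⟩ := h.exists_right_inv
    have h1 := congrArg (· * (T 1 : B[T;T⁻¹])) (congrArg Subtype.val hv)
    have h2 : (v : B[T;T⁻¹]) = T 1 := by
      calc (v : B[T;T⁻¹]) = (T (-1) * (v : B[T;T⁻¹])) * T 1 := by
            rw [mul_right_comm, ← T_add]; simp
        _ = T 1 := by simpa [u] using h1
    have h3 := Ideal.coeff_mem_of_mem_extendedRees v.2 1
    rw [h2, LaurentPolynomial.T_apply] at h3
    exact hJ ((Ideal.eq_top_iff_one _).2 (by simpa using h3))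
  have hmap : (Ideal.span (g : Set B)).map (algebraMap B E) ≤ Ideal.span {u} := by
    rw [Ideal.map_le_iff_le_comap, Ideal.span_le]
    intro a ha
    refine Ideal.mem_span_singleton.2 ⟨⟨_, hg a ha⟩, Subtype.ext ?_⟩
    change algebraMap B B[T;T⁻¹] a = T (-1) * (C a * T 1)
    rw [mul_left_comm, ← T_add]
    simp [LaurentPolynomial.algebraMap_apply]
  have h0 : algebraMap B E c = 0 := by
    refine Ideal.eq_zero_of_forall_mem_integralClosureMod_span_pow hu0 hu fun n hn ↦ ?_
    refine Ideal.map_integralClosureMod_le (algebraMap B E) ?_ (by simp)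
      (Ideal.mem_map_of_mem _ (hc n hn))
    rw [Ideal.map_pow]
    exact Ideal.pow_right_mono hmap n
  have h1 : (C c : B[T;T⁻¹]) = 0 := congrArg Subtype.val h0
  simpa [LaurentPolynomial.C_apply] using congrArg (fun f ↦ f.coeff 0) h1

lemma Ideal.eq_zero_of_forall_exists_mul_mem_integralClosureMod_pow {B : Type*} [CommRing B]
    [IsDomain B] [IsNoetherianRing B] {J P : Ideal B} [P.IsPrime] (hJ : J ≤ P) {c : B}
    (hc : ∀ n, 1 ≤ n → ∃ w ∉ P, w * c ∈ (J ^ n).integralClosureMod ⊥) : c = 0 := by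
  let f := algebraMap B (Localization.AtPrime P)
  have : IsDomain (Localization.AtPrime P) :=
    IsLocalization.isDomain_localization P.primeCompl_le_nonZeroDivisors
  have : IsNoetherianRing (Localization.AtPrime P) :=
    IsLocalization.isNoetherianRing P.primeCompl _ inferInstance
  have h0 : f c = 0 := by
    refine Ideal.eq_zero_of_forall_mem_integralClosureMod_pow (J := J.map f) ?_ fun n hn ↦ ?_
    · refine ne_top_of_le_ne_top (b := IsLocalRing.maximalIdeal (Localization.AtPrime P)) ?_ ?_
      · exact Ideal.IsPrime.ne_top'
      · rw [← Localization.AtPrime.map_eq_maximalIdeal]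
        exact Ideal.map_mono hJ
    · obtain ⟨w, hw, h⟩ := hc n hn
      have h := Ideal.map_integralClosureMod_le f (Ideal.map_pow f J n).le
        (Ideal.map_bot (f := f)).le (Ideal.mem_map_of_mem f h)
      rw [map_mul] at h
      exact (Ideal.unit_mul_mem_iff_mem _
        (IsLocalization.map_units _ (⟨w, hw⟩ : P.primeCompl))).1 h
  exact (IsLocalization.injective (Localization.AtPrime P) P.primeCompl_le_nonZeroDivisors)
    (h0.trans (map_zero _).symm)

end Vanishing

section Chevalley

open IsLocalRing

variable {C : Type*} [CommRing C]

lemma Ideal.exists_forall_sup_eq_of_antitone {J : Ideal C} [IsArtinianRing (C ⧸ J)]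
    {a : ℕ → Ideal C} (ha : Antitone a) : ∃ k, ∀ l, k ≤ l → a k ⊔ J = a l ⊔ J := by
  obtain ⟨k, hk⟩ := IsArtinian.monotone_stabilizes (R := C ⧸ J) (M := C ⧸ J)
    ⟨fun k ↦ OrderDual.toDual ((a k).map (Ideal.Quotient.mk J)),
      fun i j h ↦ Ideal.map_mono (ha h)⟩
  refine ⟨k, fun l hl ↦ ?_⟩
  have h : (a k).map (Ideal.Quotient.mk J) = (a l).map (Ideal.Quotient.mk J) := hk l hl
  have h' := congrArg (Ideal.comap (Ideal.Quotient.mk J)) h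
  rw [Ideal.comap_map_of_surjective _ Ideal.Quotient.mk_surjective,
    Ideal.comap_map_of_surjective _ Ideal.Quotient.mk_surjective, ← RingHom.ker_eq_comap_bot,
    Ideal.mk_ker] at h'
  exact h'

variable [IsLocalRing C] [IsNoetherianRing C]

lemma IsLocalRing.mem_of_forall_mem_sup_maximalIdeal_pow {b : Ideal C} {x : C}
    (hx : ∀ n, x ∈ b ⊔ maximalIdeal C ^ n) : x ∈ b := by
  have h := IsHausdorff.haus (I := maximalIdeal C) (M := C ⧸ b) inferInstance
    (Ideal.Quotient.mk b x) fun n ↦ ?_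
  · exact Ideal.Quotient.eq_zero_iff_mem.1 h
  · rw [SModEq.zero]
    obtain ⟨y, hy, z, hz, rfl⟩ := Submodule.mem_sup.1 (hx n)
    rw [map_add, Ideal.Quotient.eq_zero_iff_mem.2 hy, zero_add]
    have := Submodule.smul_mem_smul (N := (⊤ : Submodule C (C ⧸ b))) hz
      (Submodule.mem_top (x := 1))
    convert this using 1
    rw [Algebra.smul_def, mul_one]
    rfl

instance IsLocalRing.isArtinianRing_quotient_maximalIdeal_pow (n : ℕ) :
    IsArtinianRing (C ⧸ maximalIdeal C ^ n) := by
  rcases n with _ | n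
  · rw [pow_zero]
    have : Subsingleton (C ⧸ (1 : Ideal C)) := Ideal.Quotient.subsingleton_iff.2 Ideal.one_eq_top
    infer_instance
  · refine IsLocalRing.quotient_artinian_of_mem_minimalPrimes_of_isLocalRing _ ?_
    rw [← Ideal.radical_minimalPrimes, Ideal.radical_pow _ n.succ_ne_zero,
      (maximalIdeal.isMaximal C).isPrime.radical, Ideal.minimalPrimes_eq_subsingleton_self]
    rfl

/-- A version of Chevalley's theorem on decreasing sequences of ideals in a complete Noetherian
local ring. -/
lemma IsLocalRing.exists_le_of_iInf_le [IsAdicComplete (maximalIdeal C) C] {a : ℕ → Ideal C}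
    (ha : Antitone a) {E : Ideal C} (hE : ⨅ k, a k ≤ E) {t k₀ : ℕ}
    (ht : maximalIdeal C ^ t * a k₀ ≤ E) : ∃ k, k₀ ≤ k ∧ a k ≤ E := by
  choose κ hκ using fun j ↦
    Ideal.exists_forall_sup_eq_of_antitone (J := maximalIdeal C ^ j) ha
  obtain ⟨j₀, hj⟩ := (maximalIdeal C).exists_pow_inf_eq_pow_smul (a k₀)
  set j := j₀ + t
  have hjE : maximalIdeal C ^ j ⊓ a k₀ ≤ E := by
    have h := hj j (by omega)
    rw [show j - j₀ = t by omega] at h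
    simp only [smul_eq_mul, Ideal.mul_top] at h
    rw [h]
    exact (Ideal.mul_mono_right inf_le_right).trans ht
  have hstep : ∀ i, ∀ x ∈ a (κ i) ⊔ maximalIdeal C ^ i,
      ∃ y ∈ a (κ (i + 1)) ⊔ maximalIdeal C ^ (i + 1), x - y ∈ maximalIdeal C ^ i := by
    intro i x hx
    rw [hκ i _ (le_max_left (κ i) (κ (i + 1)))] at hx
    obtain ⟨y, hy, z, hz, rfl⟩ := Submodule.mem_sup.1 hx
    exact ⟨y, Ideal.mem_sup_left (ha (le_max_right _ _) hy), by simpa⟩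
  choose! g hg hg' using hstep
  refine ⟨max k₀ (κ j), le_max_left _ _, fun x hx ↦ ?_⟩
  let f : ℕ → C := fun n ↦ Nat.rec x (fun i y ↦ g (j + i) y) n
  have hf : ∀ n, f n ∈ a (κ (j + n)) ⊔ maximalIdeal C ^ (j + n) := by
    intro n
    induction n with
    | zero => exact Ideal.mem_sup_left (ha (le_max_right _ _) hx)
    | succ n ih => exact hg _ _ ih
  have hf' : ∀ n, f n - f (n + 1) ∈ maximalIdeal C ^ (j + n) := fun n ↦ hg' _ _ (hf n)
  have hcau : ∀ m n, m ≤ n → f m - f n ∈ maximalIdeal C ^ (j + m) := by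
    intro m n hmn
    induction n, hmn using Nat.le_induction with
    | base => simp
    | succ n hmn ih =>
      rw [← sub_add_sub_cancel _ (f n)]
      exact add_mem ih (Ideal.pow_le_pow_right (by omega) (hf' n))
  obtain ⟨y, hy⟩ := IsPrecomplete.prec (I := maximalIdeal C) (M := C) inferInstance (f := f)
    fun {m n} h ↦ by
      rw [SModEq.sub_mem, smul_eq_mul, Ideal.mul_top]
      exact Ideal.pow_le_pow_right (by omega) (hcau m n h)
  replace hy : ∀ n, f n - y ∈ maximalIdeal C ^ n := fun n ↦ by
    simpa [SModEq.sub_mem] using hy n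
  have hya : ∀ l, y ∈ a l := by
    refine fun l ↦ IsLocalRing.mem_of_forall_mem_sup_maximalIdeal_pow fun n ↦ ?_
    have h1 := hf n
    rw [hκ _ _ (le_max_left _ l)] at h1
    have h2 : a (max (κ (j + n)) l) ⊔ maximalIdeal C ^ (j + n) ≤ a l ⊔ maximalIdeal C ^ n :=
      sup_le_sup (ha (le_max_right _ _)) (Ideal.pow_le_pow_right (by omega))
    rw [← sub_sub_cancel (f n) y]
    exact sub_mem (h2 h1) (Ideal.mem_sup_right (hy n))
  have hxy : x - y ∈ maximalIdeal C ^ j := by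
    have h := add_mem (hcau 0 j (by omega)) (hy j)
    rwa [sub_add_sub_cancel] at h
  have := hjE ⟨hxy, sub_mem (ha (le_max_left _ _) hx) (hya k₀)⟩
  simpa using add_mem this (hE ((Submodule.mem_iInf _).2 hya))

end Chevalley

section FlatColon

lemma Ideal.mem_map_colon_of_flat {R C : Type*} [CommRing R] [CommRing C] [Algebra R C]
    [Module.Flat R C] {b : Ideal R} (hb : b.FG) {t : R} {c : C}
    (h : algebraMap R C t * c ∈ b.map (algebraMap R C)) {L : Ideal R}
    (hL : ∀ x, t * x ∈ b → x ∈ L) :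
    c ∈ L.map (algebraMap R C) := by
  obtain ⟨g, rfl⟩ := hb
  rw [Ideal.map_span] at h
  obtain ⟨y, hy⟩ := (Submodule.mem_span_image_finset_iff_exists_fun C).1 h
  let f : Option g → R := fun i ↦ i.elim t (fun i ↦ (i : R))
  let x : Option g → C := fun i ↦ i.elim c (fun i ↦ -y i)
  have hrel : ∑ i, f i • x i = 0 := by
    rw [Fintype.sum_option]
    simp only [f, x, Option.elim, Algebra.smul_def, mul_neg, Finset.sum_neg_distrib, ← hy]
    rw [← sub_eq_add_neg, sub_eq_zero]
    exact Finset.sum_congr rfl fun i _ ↦ mul_comm _ _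
  obtain ⟨k, a, z, hz, ha⟩ := Module.Flat.isTrivialRelation_of_sum_smul_eq_zero
    (R := R) (M := C) (f := f) (x := x) hrel
  have hc : c = _ := hz none
  rw [hc]
  refine Submodule.sum_mem _ fun j _ ↦ ?_
  rw [Algebra.smul_def]
  refine Ideal.mul_mem_right _ _ (Ideal.mem_map_of_mem _ (hL _ ?_))
  have := ha j
  rw [Fintype.sum_option, add_eq_zero_iff_eq_neg] at this
  simp only [f, Option.elim] at this
  rw [this]
  exact Submodule.neg_mem _ (Submodule.sum_mem _ fun i _ ↦
    Ideal.mul_mem_right _ _ (Ideal.subset_span i.2))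

end FlatColon

section Core

open IsLocalRing

/-- The properties of the completion of the localization of a Noetherian ring at a prime ideal
that are used below. -/
structure Ideal.IsCompletionAt {R : Type*} [CommRing R] (p : Ideal R) (C : Type*) [CommRing C]
    [IsLocalRing C] [Algebra R C] : Prop where
  isNoetherianRing : IsNoetherianRing C
  isAdicComplete : IsAdicComplete (maximalIdeal C) C
  flat : Module.Flat R C
  map_eq : p.map (algebraMap R C) = maximalIdeal C
  exists_mul_mem : ∀ (b : Ideal R) (r : R), algebraMap R C r ∈ b.map (algebraMap R C) →
    ∃ u ∉ p, u * r ∈ b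

variable {R : Type*} [CommRing R]

/-- The saturation `S(J)` of an ideal `J` with respect to a submonoid `S`. -/
def Ideal.saturation (S : Submonoid R) (J : Ideal R) : Ideal R where
  carrier := {x | ∃ s ∈ S, s * x ∈ J}
  add_mem' := by
    rintro x y ⟨s, hs, hx⟩ ⟨t, ht, hy⟩
    refine ⟨s * t, S.mul_mem hs ht, ?_⟩
    rw [show s * t * (x + y) = t * (s * x) + s * (t * y) by ring]
    exact add_mem (J.mul_mem_left _ hx) (J.mul_mem_left _ hy)
  zero_mem' := ⟨1, S.one_mem, by simp⟩
  smul_mem' := by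
    rintro c x ⟨s, hs, hx⟩
    refine ⟨s, hs, ?_⟩
    rw [smul_eq_mul, mul_left_comm]
    exact J.mul_mem_left _ hx

/-- The complement of the union of the minimal primes of an ideal. -/
def Ideal.minimalPrimesCompl (K : Ideal R) : Submonoid R where
  carrier := {s | ∀ p ∈ K.minimalPrimes, s ∉ p}
  one_mem' := fun _ hp ↦ hp.isPrime.one_notMem
  mul_mem' := fun hs ht p hp h ↦ (hp.isPrime.mem_or_mem h).elim (hs p hp) (ht p hp)

/-- The saturation of the integral closure of `I ^ n` relative to `a` with respect to the
complement of the union of the minimal primes of `I ⊔ a`. -/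
def Ideal.satClosure (I a : Ideal R) (n : ℕ) : Ideal R :=
  ((I ^ n).integralClosureMod a).saturation (I ⊔ a).minimalPrimesCompl

lemma Ideal.satClosure_antitone (I a : Ideal R) : Antitone (I.satClosure a) := by
  rintro m n h x ⟨s, hs, hx⟩
  exact ⟨s, hs, Ideal.integralClosureMod_mono a (Ideal.pow_le_pow_right h) hx⟩

open scoped Classical in
lemma Ideal.exists_notMem_forall_mul_mem {p L E : Ideal R} [p.IsPrime] (hL : L.FG)
    (h : ∀ x ∈ L, ∃ u ∉ p, u * x ∈ E) : ∃ u ∉ p, ∀ x ∈ L, u * x ∈ E := by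
  obtain ⟨g, rfl⟩ := hL
  have h' : ∀ x : g, ∃ u ∉ p, u * x ∈ E := fun x ↦ h x (Ideal.subset_span x.2)
  choose u hu hx using h'
  refine ⟨∏ x, u x, ?_, ?_⟩
  · exact fun hm ↦ by
      obtain ⟨x, -, hx⟩ := (Ideal.IsPrime.prod_mem_iff).1 hm
      exact hu x hx
  · intro x hxs
    have hle : Ideal.span (g : Set R) ≤ E.colon {∏ x, u x} := by
      rw [Ideal.span_le]
      intro y hy
      refine Submodule.mem_colon_singleton.2 ?_
      rw [smul_eq_mul, ← Finset.mul_prod_erase _ _ (Finset.mem_univ ⟨y, hy⟩), ← mul_assoc,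
        mul_comm y]
      exact E.mul_mem_right _ (hx ⟨y, hy⟩)
    simpa [mul_comm] using Submodule.mem_colon_singleton.1 (hle hxs)

lemma Ideal.exists_mem_colon_of_antitone [IsNoetherianRing R] (E : Ideal R) {L : ℕ → Ideal R}
    (hL : Antitone L) :
    ∃ k₀, ∀ u k, (∀ x ∈ L k, u * x ∈ E) → u ∈ E.colon (L k₀ : Set R) := by
  obtain ⟨k₀, hk₀⟩ := monotone_stabilizes_iff_noetherian.2 ‹IsNoetherianRing R›
    ⟨fun k ↦ E.colon (L k : Set R), fun i j hij x hx ↦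
      Submodule.mem_colon.2 fun y hy ↦ Submodule.mem_colon.1 hx y (hL hij hy)⟩
  refine ⟨k₀, fun u k hu ↦ ?_⟩
  have h : E.colon (L k₀ : Set R) = E.colon (L (max k₀ k) : Set R) := hk₀ _ (le_max_left _ _)
  rw [h]
  exact Submodule.mem_colon.2 fun x hx ↦ hu x (hL (le_max_right _ _) hx)

namespace Ideal.IsCompletionAt

variable {I a p : Ideal R} {C : Type*} [CommRing C] [IsLocalRing C] [Algebra R C]

lemma algebraMap_mem_iff (hp : p.IsPrime) (hC : p.IsCompletionAt C) {r : R} :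
    algebraMap R C r ∈ maximalIdeal C ↔ r ∈ p := by
  rw [← hC.map_eq]
  refine ⟨fun h ↦ ?_, Ideal.mem_map_of_mem _⟩
  obtain ⟨u, hu, h⟩ := hC.exists_mul_mem p r h
  exact (hp.mem_or_mem h).resolve_left hu

lemma isUnit_algebraMap (hp : p.IsPrime) (hC : p.IsCompletionAt C) {r : R} (hr : r ∉ p) :
    IsUnit (algebraMap R C r) := by
  rwa [← notMem_maximalIdeal, hC.algebraMap_mem_iff hp]

lemma map_le (hC : p.IsCompletionAt C) (h : I ≤ p) :
    I.map (algebraMap R C) ≤ maximalIdeal C := hC.map_eq ▸ Ideal.map_mono h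

lemma maximalIdeal_le_radical (hC : p.IsCompletionAt C) (hp : p ∈ I.minimalPrimes) :
    maximalIdeal C ≤ (I.map (algebraMap R C)).radical := by
  rw [← hC.map_eq, Ideal.map_le_iff_le_comap]
  intro x hx
  obtain ⟨y, hy, n, h⟩ := Ideal.exists_mul_pow_mem_of_mem_minimalPrimes hp hx
  refine ⟨n, ?_⟩
  have h := Ideal.mem_map_of_mem (algebraMap R C) h
  rw [map_mul, map_pow] at h
  exact (Ideal.unit_mul_mem_iff_mem _ (hC.isUnit_algebraMap hp.isPrime hy)).1 h

lemma exists_radical_eq (hC : p.IsCompletionAt C) (hp : p ∈ (I ⊔ a).minimalPrimes) :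
    ∃ q ∈ (a.map (algebraMap R C)).minimalPrimes,
      (I.map (algebraMap R C) ⊔ q).radical = maximalIdeal C := by
  obtain ⟨q, hq, hqm⟩ := Ideal.exists_minimalPrimes_le (hC.map_le (le_sup_right.trans hp.1.2))
  refine ⟨q, hq, le_antisymm ?_ ?_⟩
  · exact Ideal.IsPrime.radical_le_iff (maximalIdeal.isMaximal C).isPrime |>.2
      (sup_le (hC.map_le (le_sup_left.trans hp.1.2)) hqm)
  · refine (hC.maximalIdeal_le_radical hp).trans (Ideal.radical_mono ?_)
    rw [Ideal.map_sup]
    exact sup_le_sup_left hq.1.2 _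

lemma mem_minimalPrimes_of_radical_eq [IsNoetherianRing R] (hp : p.IsPrime)
    (hC : p.IsCompletionAt C) {q : Ideal C} (hq : q ∈ (a.map (algebraMap R C)).minimalPrimes)
    (hrad : (I.map (algebraMap R C) ⊔ q).radical = maximalIdeal C)
    (h : ∀ n, 1 ≤ n → ∃ k, I.satClosure a k ≤ (I ^ n).integralClosureMod a) :
    p ∈ (I ⊔ a).minimalPrimes := by
  have := hC.isNoetherianRing
  have := hC.flat
  have := hq.isPrime
  have hle : I.map (algebraMap R C) ⊔ q ≤ maximalIdeal C := hrad ▸ Ideal.le_radical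
  have hIp : I ⊔ a ≤ p := by
    intro x hx
    rw [← hC.algebraMap_mem_iff hp]
    refine hle ?_
    have := Ideal.mem_map_of_mem (algebraMap R C) hx
    rw [Ideal.map_sup] at this
    exact sup_le_sup_left hq.1.2 _ this
  by_contra hpm
  obtain ⟨s, hsp, hs⟩ : ∃ s ∈ p, s ∈ (I ⊔ a).minimalPrimesCompl := by
    by_contra! hcon
    have hfin := Ideal.finite_minimalPrimes_of_isNoetherianRing R (I ⊔ a)
    have hsub : (p : Set R) ⊆ ⋃ i ∈ (hfin.toFinset : Set (Ideal R)), ((id i : Ideal R) : Set R) := by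
      intro s hs
      have := hcon s hs
      change ¬ ∀ p ∈ (I ⊔ a).minimalPrimes, s ∉ p at this
      push Not at this
      simpa using this
    obtain ⟨p', hp', hpp'⟩ := (Ideal.subset_union_prime (f := id) ⊥ ⊥
      fun i hi _ _ ↦ (hfin.mem_toFinset.1 hi).isPrime).1 hsub
    have hp' := hfin.mem_toFinset.1 hp'
    have : p = p' := le_antisymm hpp' (hp'.2 ⟨hp, hIp⟩ hpp')
    exact hpm (this ▸ hp')
  obtain ⟨m, hm⟩ : algebraMap R C s ∈ (I.map (algebraMap R C) ⊔ q).radical := by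
    rwa [hrad, hC.algebraMap_mem_iff hp]
  obtain ⟨i, hi, z, hz, hiz⟩ := Submodule.mem_sup.1 hm
  obtain ⟨c, hcq, e, hce⟩ := Ideal.exists_mul_pow_mem_of_mem_minimalPrimes hq hz
  have hcL : ∀ k, c ∈ (I.satClosure a k).map (algebraMap R C) := by
    intro k
    refine Ideal.mem_map_colon_of_flat (b := I ^ k ⊔ a) (t := s ^ (m * (k + e)))
      ((isNoetherianRing_iff_ideal_fg R).1 inferInstance _) ?_ fun x hx ↦
        ⟨_, pow_mem hs _, Ideal.sup_le_integralClosureMod _ _ hx⟩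
    rw [map_pow, pow_mul, ← hiz, Ideal.map_sup, Ideal.map_pow, mul_comm, add_pow, Finset.mul_sum]
    refine Submodule.sum_mem _ fun j hj ↦ ?_
    rw [← mul_assoc]
    refine Ideal.mul_mem_right _ _ ?_
    by_cases hjk : k ≤ j
    · refine Ideal.mem_sup_left (Ideal.mul_mem_left _ _ (Ideal.mul_mem_right _ _ ?_))
      exact Ideal.pow_le_pow_right hjk (Ideal.pow_mem_pow hi j)
    · refine Ideal.mem_sup_right ?_
      obtain ⟨l, hl⟩ := Nat.exists_eq_add_of_le (show e ≤ k + e - j by omega)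
      rw [hl, pow_add, show c * (i ^ j * (z ^ e * z ^ l)) = i ^ j * z ^ l * (c * z ^ e) by ring]
      exact Ideal.mul_mem_left _ _ hce
  refine hcq (Ideal.Quotient.eq_zero_iff_mem.1 ?_)
  refine Ideal.eq_zero_of_forall_mem_integralClosureMod_pow
    (J := (I.map (algebraMap R C)).map (Ideal.Quotient.mk q)) ?_ fun n hn ↦ ?_
  · intro htop
    have := congrArg (Ideal.comap (Ideal.Quotient.mk q)) htop
    rw [Ideal.comap_map_of_surjective _ Ideal.Quotient.mk_surjective, ← RingHom.ker_eq_comap_bot,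
      Ideal.mk_ker, Ideal.comap_top] at this
    exact (maximalIdeal.isMaximal C).ne_top (top_le_iff.1 (this ▸ hle))
  · obtain ⟨k, hk⟩ := h n hn
    have h1 := Ideal.map_mono (f := algebraMap R C) hk (hcL k)
    have h2 := Ideal.map_integralClosureMod_le (algebraMap R C)
      (Ideal.map_pow (algebraMap R C) I n).le le_rfl h1
    refine Ideal.map_integralClosureMod_le (Ideal.Quotient.mk q) (Ideal.map_pow _ _ n).le
      ?_ (Ideal.mem_map_of_mem _ h2)
    rw [le_bot_iff, Ideal.map_eq_bot_iff_le_ker, Ideal.mk_ker]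
    exact hq.1.2

lemma exists_prime_of_radical_ne (hC : p.IsCompletionAt C) (hIp : I ≤ p) {q : Ideal C}
    (hq : q.IsPrime) (hrad : (I.map (algebraMap R C) ⊔ q).radical ≠ maximalIdeal C) :
    ∃ P : Ideal C, P.IsPrime ∧ I.map (algebraMap R C) ⊔ q ≤ P ∧ P ≠ maximalIdeal C := by
  by_contra! hcon
  refine hrad (le_antisymm ?_ ?_)
  · exact Ideal.IsPrime.radical_le_iff (maximalIdeal.isMaximal C).isPrime |>.2
      (sup_le (hC.map_le hIp) (le_maximalIdeal hq.ne_top))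
  · rw [Ideal.radical_eq_sInf]
    exact le_sInf fun P hP ↦ (hcon P hP.2 hP.1).ge

lemma comap_lt (hp : p.IsPrime) (hC : p.IsCompletionAt C) {P : Ideal C} (hP : P.IsPrime)
    (hne : P ≠ maximalIdeal C) : P.comap (algebraMap R C) < p := by
  have hle : P ≤ maximalIdeal C := le_maximalIdeal hP.ne_top
  refine lt_of_le_of_ne (fun x hx ↦ (hC.algebraMap_mem_iff hp).1 (hle hx)) fun h ↦ hne ?_
  refine le_antisymm hle ?_
  rw [← hC.map_eq, Ideal.map_le_iff_le_comap, h]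

lemma mem_of_forall_exists_mul_mem (hC : p.IsCompletionAt C) {q P : Ideal C}
    (hq : q ∈ (a.map (algebraMap R C)).minimalPrimes) (hP : P.IsPrime)
    (hle : I.map (algebraMap R C) ⊔ q ≤ P) {c : C}
    (hc : ∀ n, 1 ≤ n → ∃ u : R, u ∉ P.comap (algebraMap R C) ∧
      algebraMap R C u * c ∈ ((I ^ n).integralClosureMod a).map (algebraMap R C)) : c ∈ q := by
  have := hC.isNoetherianRing
  have := hq.isPrime
  have hqP : q ≤ P := le_sup_right.trans hle
  have hPq : (P.map (Ideal.Quotient.mk q)).IsPrime :=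
    Ideal.map_isPrime_of_surjective Ideal.Quotient.mk_surjective (by rwa [Ideal.mk_ker])
  refine Ideal.Quotient.eq_zero_iff_mem.1 ?_
  refine Ideal.eq_zero_of_forall_exists_mul_mem_integralClosureMod_pow
    (J := (I.map (algebraMap R C)).map (Ideal.Quotient.mk q)) (P := P.map (Ideal.Quotient.mk q))
    (Ideal.map_mono (le_sup_left.trans hle)) fun n hn ↦ ?_
  obtain ⟨u, hu, huc⟩ := hc n hn
  refine ⟨Ideal.Quotient.mk q (algebraMap R C u), fun h ↦ hu ?_, ?_⟩
  · have h : algebraMap R C u ∈ (P.map (Ideal.Quotient.mk q)).comap (Ideal.Quotient.mk q) := h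
    rw [Ideal.comap_map_of_surjective _ Ideal.Quotient.mk_surjective, ← RingHom.ker_eq_comap_bot,
      Ideal.mk_ker, sup_eq_left.2 hqP] at h
    exact h
  · rw [← map_mul]
    have h2 := Ideal.map_integralClosureMod_le (algebraMap R C)
      (Ideal.map_pow (algebraMap R C) I n).le le_rfl huc
    refine Ideal.map_integralClosureMod_le (Ideal.Quotient.mk q) (Ideal.map_pow _ _ n).le
      ?_ (Ideal.mem_map_of_mem _ h2)
    rw [le_bot_iff, Ideal.map_eq_bot_iff_le_ker, Ideal.mk_ker]
    exact hq.1.2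

lemma exists_notMem_forall_mul_mem_integralClosureMod [IsNoetherianRing R] (hp : p.IsPrime)
    (hC : p.IsCompletionAt C) (hIp : I ⊔ a ≤ p)
    (hrad : ∀ q ∈ (a.map (algebraMap R C)).minimalPrimes,
      (I.map (algebraMap R C) ⊔ q).radical ≠ maximalIdeal C)
    {L : ℕ → Ideal R} (hL : Antitone L)
    (ih : ∀ p' : Ideal R, p'.IsPrime → p' < p → ∀ n, ∃ u ∉ p', ∃ k, ∀ x ∈ L k,
      u * x ∈ (I ^ n).integralClosureMod a) (n : ℕ) :
    ∃ u ∉ p, ∃ k, ∀ x ∈ L k, u * x ∈ (I ^ n).integralClosureMod a := by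
  have := hC.isNoetherianRing
  have := hC.isAdicComplete
  set φ := algebraMap R C
  have hinf : ⨅ k, (L k).map φ ≤ (a.map φ).radical := by
    intro c hc
    rw [← Ideal.sInf_minimalPrimes, Submodule.mem_sInf]
    intro q hq
    obtain ⟨P, hP, hle, hne⟩ := hC.exists_prime_of_radical_ne (le_sup_left.trans hIp)
      hq.isPrime (hrad q hq)
    refine hC.mem_of_forall_exists_mul_mem hq hP hle fun n _ ↦ ?_
    obtain ⟨u, hu, k, hk⟩ := ih _ (hP.comap _) (hC.comap_lt hp hP hne) n
    refine ⟨u, hu, ?_⟩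
    have hspan : Ideal.span {u} * L k ≤ (I ^ n).integralClosureMod a := by
      rw [Ideal.span_singleton_mul_le_iff]
      exact hk
    refine Ideal.map_mono hspan ?_
    rw [Ideal.map_mul]
    exact Ideal.mul_mem_mul (Ideal.mem_map_of_mem _ (Ideal.mem_span_singleton_self u))
      ((Submodule.mem_iInf _).1 hc k)
  set E := ((I.map φ) ^ n).integralClosureMod (a.map φ)
  have hE : ⨅ k, (L k).map φ ≤ E := hinf.trans fun x ⟨m, hm⟩ ↦
    Ideal.mem_integralClosureMod.2 (.of_pow_mem hm)
  obtain ⟨k₀, hD⟩ := Ideal.exists_mem_colon_of_antitone ((I ^ n).integralClosureMod a) hL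
  set D := ((I ^ n).integralClosureMod a).colon (L k₀ : Set R)
  have hDL : D * L k₀ ≤ (I ^ n).integralClosureMod a :=
    Ideal.mul_le.2 fun u hu x hx ↦ Submodule.mem_colon.1 hu x hx
  by_cases hDp : D ≤ p
  swap
  · obtain ⟨u, hu, hup⟩ := Set.not_subset.1 hDp
    exact ⟨u, hup, k₀, Submodule.mem_colon.1 hu⟩
  have hpD : p ∈ D.minimalPrimes := by
    refine ⟨⟨hp, hDp⟩, fun p' hp' hle ↦ ?_⟩
    by_contra hne
    obtain ⟨u, hu, k, hk⟩ := ih p' hp'.1 (lt_of_le_not_ge hle hne) n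
    exact hu (hp'.2 (hD u k hk))
  obtain ⟨t, ht⟩ := Ideal.exists_pow_le_of_le_radical_of_fg (hC.maximalIdeal_le_radical hpD)
    ((isNoetherianRing_iff_ideal_fg C).1 inferInstance _)
  obtain ⟨k, -, hk⟩ := IsLocalRing.exists_le_of_iInf_le (a := fun k ↦ (L k).map φ)
    (fun i j hij ↦ Ideal.map_mono (hL hij)) hE (t := t) (k₀ := k₀) <| by
      refine (Ideal.mul_mono_left ht).trans ?_
      rw [← Ideal.map_mul]
      exact (Ideal.map_mono hDL).trans
        (Ideal.map_integralClosureMod_le φ (Ideal.map_pow φ I n).le le_rfl)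
  obtain ⟨u, hu, h⟩ := Ideal.exists_notMem_forall_mul_mem (p := p) (L := L k)
    (E := (I ^ n).integralClosureMod a) ((isNoetherianRing_iff_ideal_fg R).1 inferInstance _)
    fun x hx ↦ by
      simp only [Ideal.mem_integralClosureMod]
      refine Ideal.IntDepMod.exists_mul_of_map (f := φ) hC.exists_mul_mem ?_
      rw [Ideal.map_pow]
      exact Ideal.mem_integralClosureMod.1 (hk (Ideal.mem_map_of_mem _ hx))
  exact ⟨u, hu, k, h⟩

end Ideal.IsCompletionAt

universe v in
lemma Ideal.exists_satClosure_le_integralClosureMod [IsNoetherianRing R] {I a : Ideal R}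
    (h : ∀ p : Ideal R, p.IsPrime → I ⊔ a ≤ p → p ∉ (I ⊔ a).minimalPrimes →
      ∃ (C : Type v) (_ : CommRing C) (_ : IsLocalRing C) (_ : Algebra R C),
        p.IsCompletionAt C ∧ ∀ q ∈ (a.map (algebraMap R C)).minimalPrimes,
          (I.map (algebraMap R C) ⊔ q).radical ≠ maximalIdeal C) (n : ℕ) :
    ∃ k, I.satClosure a k ≤ (I ^ n).integralClosureMod a := by
  have key : ∀ (m : ℕ∞) (p : Ideal R), p.IsPrime → p.height = m → ∀ n, ∃ u ∉ p, ∃ k,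
      ∀ x ∈ I.satClosure a k, u * x ∈ (I ^ n).integralClosureMod a := by
    intro m
    induction m using WellFoundedLT.induction with | ind m ih => ?_
    intro p hp hm n
    by_cases hIp : I ⊔ a ≤ p
    swap
    · obtain ⟨u, hu, hup⟩ : ∃ u ∈ (I ^ n).integralClosureMod a, u ∉ p := by
        have hsup := Ideal.sup_le_integralClosureMod (I ^ n) a
        by_contra! hcon
        refine hIp (sup_le (fun x hx ↦ ?_) fun x hx ↦ ?_)
        · exact hp.mem_of_pow_mem n (hcon _ (hsup (Ideal.mem_sup_left (Ideal.pow_mem_pow hx n))))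
        · exact hcon x (hsup (Ideal.mem_sup_right hx))
      exact ⟨u, hup, 0, fun x _ ↦ Ideal.mul_mem_right _ _ hu⟩
    by_cases hpm : p ∈ (I ⊔ a).minimalPrimes
    · obtain ⟨u, hu, hk⟩ := Ideal.exists_notMem_forall_mul_mem (p := p) (L := I.satClosure a n)
        (E := (I ^ n).integralClosureMod a) ((isNoetherianRing_iff_ideal_fg R).1 inferInstance _)
        fun x ⟨s, hs, hx⟩ ↦ ⟨s, hs p hpm, hx⟩
      exact ⟨u, hu, n, hk⟩
    obtain ⟨C, _, _, _, hC, hrad⟩ := h p hp hIp hpm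
    refine hC.exists_notMem_forall_mul_mem_integralClosureMod hp hIp hrad
      (I.satClosure_antitone a) (fun p' hp' hlt ↦ ?_) n
    exact ih _ (hm ▸ Ideal.height_strict_mono_of_isPrime hlt) p' hp' rfl
  obtain ⟨k₀, hD⟩ := Ideal.exists_mem_colon_of_antitone ((I ^ n).integralClosureMod a)
    (I.satClosure_antitone a)
  refine ⟨k₀, fun x hx ↦ ?_⟩
  have htop : ((I ^ n).integralClosureMod a).colon (I.satClosure a k₀ : Set R) = ⊤ := by
    by_contra hne
    obtain ⟨p, hp, hle⟩ := Ideal.exists_le_maximal _ hne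
    obtain ⟨u, hu, k, hk⟩ := key _ p hp.isPrime rfl n
    exact hu (hle (hD u k hk))
  simpa using Submodule.mem_colon.1 ((Ideal.eq_top_iff_one _).1 htop) x hx

end Core

section CompletionNoetherian

open Ideal

lemma AdicCompletion.exists_ringHom_comp_algebraMap {P O : Type*} [CommRing P] [CommRing O]
    (φ : P →+* O) {J : Ideal P} {I : Ideal O} (hJ : J.map φ ≤ I) :
    ∃ F : AdicCompletion J P →+* AdicCompletion I O,
      F.comp (algebraMap P _) = (algebraMap O _).comp φ := by
  have hle (n : ℕ) : J ^ n ≤ (I ^ n).comap φ := by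
    rw [← Ideal.map_le_iff_le_comap, Ideal.map_pow]
    exact Ideal.pow_right_mono hJ n
  let f (n : ℕ) : AdicCompletion J P →+* O ⧸ I ^ n :=
    (Ideal.quotientMap _ φ (hle n)).comp (AdicCompletion.evalₐ J n : _ →+* _)
  have hf {m n : ℕ} (h : m ≤ n) : (Ideal.Quotient.factorPow I h).comp (f n) = f m := by
    ext x
    obtain ⟨x, rfl⟩ := AdicCompletion.mk_surjective J P x
    simp only [f, RingHom.comp_apply, RingHom.coe_coe, AdicCompletion.evalₐ_mk]
    rw [← AdicCompletion.Ideal.mk_eq_mk J h x]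
    rfl
  refine ⟨AdicCompletion.liftRingHom I f hf, ?_⟩
  ext x : 1
  apply AdicCompletion.ext_evalₐ
  intro n
  simp [f, AdicCompletion.algebraMap_apply]

instance AdicCompletion.isNoetherianRing {O : Type*} [CommRing O] [IsNoetherianRing O]
    (I : Ideal O) : IsNoetherianRing (AdicCompletion I O) := by
  obtain ⟨s, hs⟩ := IsNoetherian.noetherian I
  let φ : MvPolynomial s O →+* O := (MvPolynomial.aeval (fun i : s ↦ (i : O))).toRingHom
  let J := MvPolynomial.idealOfVars s O
  have hφ : J.map φ = I := by
    rw [← hs, show J = Ideal.span _ from rfl, Ideal.map_span, ← Set.range_comp]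
    congr 1
    ext x
    simp [φ]
  have hNoeth : IsNoetherianRing (AdicCompletion J (MvPolynomial s O)) :=
    isNoetherianRing_of_ringEquiv _ (MvPowerSeries.toAdicCompletionAlgEquiv s O).toRingEquiv
  obtain ⟨F, hF⟩ := AdicCompletion.exists_ringHom_comp_algebraMap φ hφ.le
  let K := J.map (algebraMap (MvPolynomial s O) (AdicCompletion J (MvPolynomial s O)))
  have hK : K.map F = I.map (algebraMap O (AdicCompletion I O)) := by
    rw [Ideal.map_map, hF, ← Ideal.map_map, hφ]
  have := AdicCompletion.isAdicComplete_self J (MvPolynomial.idealOfVars_fg s O)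
  have : IsPrecomplete K (AdicCompletion J (MvPolynomial s O)) := this.toIsPrecomplete
  have hcomp := AdicCompletion.isAdicComplete_self I (IsNoetherian.noetherian I)
  rw [← hK] at hcomp
  have : IsHausdorff (K.map F) (AdicCompletion I O) := hcomp.toIsHausdorff
  refine isNoetherianRing_of_surjective _ _ F (surjective_of_mk_map_comp_surjective (I := K) F ?_)
  intro y
  obtain ⟨y, rfl⟩ := Ideal.Quotient.mk_surjective y
  obtain ⟨z, hz⟩ := Ideal.Quotient.mk_surjective (AdicCompletion.evalOneₐ I y)
  refine ⟨algebraMap _ _ (MvPolynomial.C z : MvPolynomial s O), ?_⟩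
  have hz' : F (algebraMap _ _ (MvPolynomial.C z : MvPolynomial s O)) =
      algebraMap O (AdicCompletion I O) z := by
    have := RingHom.congr_fun hF (MvPolynomial.C z)
    simpa [φ] using this
  rw [RingHom.comp_apply, hz', Ideal.Quotient.eq, hK,
    ← AdicCompletion.ker_evalOneₐ_eq_map I (IsNoetherian.noetherian I), RingHom.mem_ker, map_sub,
    sub_eq_zero]
  exact hz

end CompletionNoetherian

section CompletionAtPrime

open IsLocalRing

variable {R : Type*} [CommRing R] [IsNoetherianRing R]

instance (p : Ideal R) [p.IsPrime] : IsScalarTower R (Localization.AtPrime p)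
    (AdicCompletion (maximalIdeal (Localization.AtPrime p)) (Localization.AtPrime p)) :=
  .of_algebraMap_eq fun _ ↦ rfl

lemma Ideal.isCompletionAt_adicCompletion (p : Ideal R) [p.IsPrime] :
    p.IsCompletionAt
      (AdicCompletion (maximalIdeal (Localization.AtPrime p)) (Localization.AtPrime p)) where
  isNoetherianRing := inferInstance
  isAdicComplete := inferInstance
  flat := Module.Flat.trans R (Localization.AtPrime p) _
  map_eq := by
    rw [IsScalarTower.algebraMap_eq R (Localization.AtPrime p), ← Ideal.map_map,
      Localization.AtPrime.map_eq_maximalIdeal, AdicCompletion.maximalIdeal_eq_map]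
  exists_mul_mem b r h := by
    let O := Localization.AtPrime p
    let C := AdicCompletion (maximalIdeal O) O
    have : Module.FaithfullyFlat O C := Module.FaithfullyFlat.of_flat_of_isLocalHom
    rw [IsScalarTower.algebraMap_eq R O, ← Ideal.map_map, RingHom.comp_apply, ← Ideal.mem_comap,
      Ideal.comap_map_eq_self_of_faithfullyFlat] at h
    obtain ⟨u, hu, hr⟩ := (IsLocalization.algebraMap_mem_map_algebraMap_iff p.primeCompl _ _ _).1 h
    exact ⟨u, hu, hr⟩

end CompletionAtPrime

section MinimalAssociatedPrimes

open IsLocalRing TensorProduct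

lemma mAss_eq_minimalPrimes_annihilator (A M : Type) [CommRing A] [IsNoetherianRing A]
    [AddCommGroup M] [Module A M] [Module.Finite A M] :
    mAss A M = (Module.annihilator A M).minimalPrimes := by
  have hsub := Module.associatedPrimes.minimalPrimes_annihilator_subset_associatedPrimes A M
  have hann {p : Ideal A} (hp : IsAssociatedPrime p M) : Module.annihilator A M ≤ p :=
    Submodule.annihilator_top.symm.le.trans hp.annihilator_le
  ext p
  refine ⟨fun hp ↦ ?_, fun hp ↦ ⟨hsub hp, fun q hq hqp ↦ hp.2 ⟨hq.isPrime, hann hq⟩ hqp⟩⟩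
  have := hp.1.isPrime
  obtain ⟨q, hq, hqp⟩ := Ideal.exists_minimalPrimes_le (hann hp.1)
  rwa [(hp.2 (hsub hq) hqp).antisymm hqp]

lemma mAss_quotient_smul_top (A M : Type) [CommRing A] [IsNoetherianRing A]
    [AddCommGroup M] [Module A M] [Module.Finite A M] (I : Ideal A) :
    mAss A (M ⧸ (I • ⊤ : Submodule A M)) = (I ⊔ Module.annihilator A M).minimalPrimes := by
  have h := Module.support_quotient (R := A) (M := M) I
  rw [Module.support_eq_zeroLocus, Module.support_eq_zeroLocus, Set.inter_comm,
    ← PrimeSpectrum.zeroLocus_sup, PrimeSpectrum.zeroLocus_eq_iff] at h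
  rw [mAss_eq_minimalPrimes_annihilator, ← Ideal.radical_minimalPrimes, h,
    Ideal.radical_minimalPrimes]

lemma Module.annihilator_tensorProduct_of_flat (A B M : Type*) [CommRing A] [CommRing B]
    [Algebra A B] [Module.Flat A B] [AddCommGroup M] [Module A M] [Module.Finite A M] :
    Module.annihilator B (B ⊗[A] M) = (Module.annihilator A M).map (algebraMap A B) := by
  refine le_antisymm (fun b hb ↦ ?_) (Ideal.map_le_iff_le_comap.2 fun a ha ↦ ?_)
  · obtain ⟨n, m, hm⟩ := Module.Finite.exists_fin (R := A) (M := M)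
    let g : A →ₗ[A] (Fin n → M) := LinearMap.pi fun i ↦ LinearMap.toSpanSingleton A M (m i)
    have hker : LinearMap.ker g = Module.annihilator A M := by
      ext a
      rw [← Submodule.annihilator_top, ← hm, Submodule.mem_annihilator_span]
      simp [g, funext_iff]
    have hex : Function.Exact (Submodule.subtype (Module.annihilator A M)) g := by
      rw [LinearMap.exact_iff, hker, Submodule.range_subtype]
    have hb' : g.lTensor B (b ⊗ₜ 1) = 0 := by
      apply (TensorProduct.piRight A A B (fun _ : Fin n ↦ M)).injective
      rw [map_zero]
      ext i
      simpa [g, smul_tmul'] using Module.mem_annihilator.1 hb (1 ⊗ₜ m i)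
    obtain ⟨z, hz⟩ := (Module.Flat.lTensor_exact B hex _).1 hb'
    have hz' : TensorProduct.rid A B ((Submodule.subtype (Module.annihilator A M)).lTensor B z) = b := by
      rw [hz]
      simp
    rw [← hz']
    clear hz' hz
    induction z with
    | zero => simp
    | add x y hx hy => simpa using add_mem hx hy
    | tmul x y =>
      simp only [LinearMap.lTensor_tmul, Submodule.subtype_apply, TensorProduct.rid_tmul,
        Algebra.smul_def]
      exact Ideal.mul_mem_right _ _ (Ideal.mem_map_of_mem _ y.2)
  · rw [Ideal.mem_comap, Module.mem_annihilator]
    intro z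
    induction z with
    | zero => simp
    | add x y hx hy => rw [smul_add, hx, hy, add_zero]
    | tmul x y =>
      rw [algebraMap_smul, ← TensorProduct.tmul_smul, Module.mem_annihilator.1 ha y, tmul_zero]

lemma mAss_adicCompletion_localizedModule {R : Type} [CommRing R] [IsNoetherianRing R]
    (N : Type) [AddCommGroup N] [Module R N] [Module.Finite R N] (p : Ideal R) [p.IsPrime] :
    mAss (AdicCompletion (maximalIdeal (Localization.AtPrime p)) (Localization.AtPrime p))
        (AdicCompletion (maximalIdeal (Localization.AtPrime p))
          (LocalizedModule p.primeCompl N)) =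
      ((Module.annihilator R N).map (algebraMap R (AdicCompletion
        (maximalIdeal (Localization.AtPrime p)) (Localization.AtPrime p)))).minimalPrimes := by
  let O := Localization.AtPrime p
  let C := AdicCompletion (maximalIdeal O) O
  let Np := LocalizedModule p.primeCompl N
  have : Module.Finite O Np := inferInstance
  let e : C ⊗[O] Np ≃ₗ[C] AdicCompletion (maximalIdeal O) Np :=
    AdicCompletion.ofTensorProductEquivOfFiniteNoetherian (maximalIdeal O) Np
  have : Module.Finite C (AdicCompletion (maximalIdeal O) Np) := Module.Finite.equiv e
  rw [mAss_eq_minimalPrimes_annihilator, ← e.annihilator_eq,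
    Module.annihilator_tensorProduct_of_flat,
    (LocalizedModule.equivTensorProduct p.primeCompl N).annihilator_eq]
  change Ideal.minimalPrimes (Ideal.map _ (Module.annihilator O (O ⊗[R] N))) = _
  rw [Module.annihilator_tensorProduct_of_flat, Ideal.map_map, ← IsScalarTower.algebraMap_eq]

end MinimalAssociatedPrimes

lemma Ideal.isQuintasymptotic_iff {R : Type} [CommRing R] [IsNoetherianRing R]
    (N : Type) [AddCommGroup N] [Module R N] [Module.Finite R N] (I p : Ideal R) [p.IsPrime] :
    I.IsQuintasymptotic p N ↔
      ∃ q ∈ ((Module.annihilator R N).map (algebraMap R (AdicCompletion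
        (IsLocalRing.maximalIdeal (Localization.AtPrime p))
        (Localization.AtPrime p)))).minimalPrimes,
      (I.map (algebraMap R (AdicCompletion (IsLocalRing.maximalIdeal (Localization.AtPrime p))
        (Localization.AtPrime p))) ⊔ q).radical = IsLocalRing.maximalIdeal _ := by
  rw [← mAss_adicCompletion_localizedModule, ← p.isCompletionAt_adicCompletion.map_eq]
  exact exists_prop_of_true ‹_›

/-- `Q̄*(I, N) = mAss_R N/IN` iff the topologies defined by `{(I^n)^{(N)}_a}` and
`{(I^n)^{⟨N⟩}_a}` are equivalent, where `(I^n)^{⟨N⟩}_a = S((I^n)^{(N)}_a)` for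
`S = R ∖ ∪ {p ∈ mAss_R N/IN}`. -/
theorem quintasymptotic_eq_mAss_iff {R : Type} [CommRing R] [IsNoetherianRing R]
    (N : Type) [AddCommGroup N] [Module R N] [Module.Finite R N] (I : Ideal R) :
    ({p : Ideal R | Ideal.IsQuintasymptotic I p N} =
        mAss R (N ⧸ (I • ⊤ : Submodule R N))) ↔
      ∀ n : ℕ, 1 ≤ n → ∃ k : ℕ, 1 ≤ k ∧
        sat {s : R | ∀ p ∈ mAss R (N ⧸ (I • ⊤ : Submodule R N)), s ∉ p}
          ((I ^ k).relIntClosure N) ⊆ (I ^ n).relIntClosure N := by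
  let a := Module.annihilator R N
  have hrel (n : ℕ) : (I ^ n).relIntClosure N = (I ^ n).integralClosureMod a :=
    Ideal.relIntClosure_eq_integralClosureMod _
  simp only [mAss_quotient_smul_top, hrel]
  change _ ↔ ∀ n, 1 ≤ n → ∃ k, 1 ≤ k ∧ I.satClosure a k ≤ (I ^ n).integralClosureMod a
  constructor
  · intro h n _
    obtain ⟨k, hk⟩ := Ideal.exists_satClosure_le_integralClosureMod (I := I) (a := a)
      (fun p hp _ hmin ↦ ⟨_, _, _, _, p.isCompletionAt_adicCompletion, fun q hq hrad ↦
        hmin (h.subset ((Ideal.isQuintasymptotic_iff N I p).2 ⟨q, hq, hrad⟩))⟩) n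
    exact ⟨k + 1, by omega, (Ideal.satClosure_antitone I a k.le_succ).trans hk⟩
  · intro h
    ext p
    constructor
    · intro hp
      have hprime : p.IsPrime := hp.1
      obtain ⟨q, hq, hrad⟩ := (Ideal.isQuintasymptotic_iff N I p).1 hp
      exact Ideal.IsCompletionAt.mem_minimalPrimes_of_radical_eq hprime
        p.isCompletionAt_adicCompletion hq hrad fun n hn ↦ (h n hn).imp fun _ ↦ And.right
    · intro hp
      have hprime : p.IsPrime := hp.isPrime
      exact (Ideal.isQuintasymptotic_iff N I p).2
        (p.isCompletionAt_adicCompletion.exists_radical_eq hp)
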